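/- arXiv:1605.05346 — 3 statements merged into one kernel-verified Lean document; each statement's English description precedes it below -/
import Mathlib

section
/- Let g̃ ∈ GL(2,ℂ) and suppose the image g of g̃ in PGL₂(ℂ) = GL(2,ℂ)/centre has finite order n ≥ 1. Then there exists a primitive n-th root of unity ζ ∈ ℂ such that trace(g̃)²/det(g̃) = 2 + ζ + ζ⁻¹. -/
/-- `c g = trace(g)² / det(g)` for an element of `GL (Fin 2) ℂ`. -/
noncomputable def cInv (g : GL (Fin 2) ℂ) : ℂ :=
  (Matrix.trace (g : Matrix (Fin 2) (Fin 2) ℂ)) ^ 2 /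
    (g : Matrix (Fin 2) (Fin 2) ℂ).det

/-- `PGL₂(ℂ)`, the quotient of `GL(2,ℂ)` by its centre. -/
abbrev PGL2C := GL (Fin 2) ℂ ⧸ Subgroup.center (GL (Fin 2) ℂ)

lemma exists_add_eq_and_mul_eq (t d : ℂ) : ∃ a b : ℂ, a + b = t ∧ a * b = d := by
  obtain ⟨r, hr⟩ := IsAlgClosed.exists_pow_nat_eq (t ^ 2 - 4 * d) two_pos
  exact ⟨(t + r) / 2, (t - r) / 2, by ring, by linear_combination (-1 / 4) * hr⟩

lemma Matrix.mul_self_eq_trace_smul_sub_det_smul (M : Matrix (Fin 2) (Fin 2) ℂ) :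
    M * M = M.trace • M - M.det • 1 := by
  ext i j
  fin_cases i <;> fin_cases j <;>
    simp [Matrix.mul_apply, Fin.sum_univ_two, Matrix.trace_fin_two, Matrix.det_fin_two] <;> ring

/-- Powers of an element `M` annihilated by `(X - a) (X - b)`, written as linear combinations
of `M` and `1`. -/
lemma exists_pow_eq_smul_add_smul_one {A : Type*} [Ring A] [Algebra ℂ A] {M : A} {a b : ℂ}
    (hM : M * M = (a + b) • M - (a * b) • (1 : A)) (k : ℕ) :
    ∃ s t : ℂ, M ^ k = s • M + t • (1 : A) ∧ a ^ k = s * a + t ∧ b ^ k = s * b + t ∧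
      (a = b → k * a ^ k = a * s) := by
  induction k with
  | zero => exact ⟨0, 1, by simp⟩
  | succ k ih =>
    obtain ⟨s, t, h, ha, hb, hab⟩ := ih
    refine ⟨(a + b) * s + t, -(a * b) * s, ?_, ?_, ?_, ?_⟩
    · rw [pow_succ, h, add_mul, smul_mul_assoc, hM, smul_one_mul]
      module
    · rw [pow_succ, ha]; ring
    · rw [pow_succ, hb]; ring
    · rintro rfl
      push_cast
      linear_combination a * hab rfl + a * ha

lemma smul_add_smul_one_mem_range_scalar_iff {M : Matrix (Fin 2) (Fin 2) ℂ}
    (hM : M ∉ Set.range (Matrix.scalar (Fin 2))) (s t : ℂ) :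
    s • M + t • (1 : Matrix (Fin 2) (Fin 2) ℂ) ∈ Set.range (Matrix.scalar (Fin 2)) ↔ s = 0 := by
  constructor
  · rintro ⟨c, hc⟩
    by_contra hs
    refine hM ⟨s⁻¹ * (c - t), ?_⟩
    have h : s • M = (c - t) • (1 : Matrix (Fin 2) (Fin 2) ℂ) := by
      rw [sub_smul, Matrix.smul_one_eq_diagonal c, ← Matrix.scalar_apply, hc]
      abel
    rw [Matrix.scalar_apply, ← Matrix.smul_one_eq_diagonal, mul_smul, ← h, inv_smul_smul₀ hs]
  · rintro rfl
    exact ⟨t, by simp [Matrix.smul_one_eq_diagonal]⟩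

lemma PGL2C.mk_pow_eq_one_iff (g : GL (Fin 2) ℂ) (k : ℕ) :
    (QuotientGroup.mk g : PGL2C) ^ k = 1 ↔
      (g : Matrix (Fin 2) (Fin 2) ℂ) ^ k ∈ Set.range (Matrix.scalar (Fin 2)) := by
  rw [← QuotientGroup.mk_pow, QuotientGroup.eq_one_iff,
    Matrix.GeneralLinearGroup.mem_center_iff_val_mem_range_scalar, Units.val_pow_eq_pow_val]

theorem c_eq_two_add_zeta_add_zeta_inv (g : GL (Fin 2) ℂ) (n : ℕ) (hn : 1 ≤ n)
    (hord : orderOf (QuotientGroup.mk g : PGL2C) = n) :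
    ∃ ζ : ℂ, IsPrimitiveRoot ζ n ∧ cInv g = 2 + ζ + ζ⁻¹ := by
  have hdet : (g : Matrix (Fin 2) (Fin 2) ℂ).det ≠ 0 := g.det_ne_zero
  have hpow := PGL2C.mk_pow_eq_one_iff g
  unfold cInv
  generalize (g : Matrix (Fin 2) (Fin 2) ℂ) = M at hdet hpow ⊢
  obtain ⟨a, b, htr, hab⟩ := exists_add_eq_and_mul_eq M.trace M.det
  have hM := M.mul_self_eq_trace_smul_sub_det_smul
  rw [← htr, ← hab] at hM ⊢
  obtain ⟨ha, hb⟩ : a ≠ 0 ∧ b ≠ 0 := mul_ne_zero_iff.mp (hab ▸ hdet)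
  by_cases hs : M ∈ Set.range (Matrix.scalar (Fin 2))
  · have h1 : n = 1 := by
      rw [← hord, orderOf_eq_one_iff, ← pow_one (QuotientGroup.mk g : PGL2C), hpow, pow_one]
      exact hs
    subst h1
    obtain ⟨c, rfl⟩ := hs
    refine ⟨1, IsPrimitiveRoot.one, ?_⟩
    simp only [Matrix.scalar_apply, Matrix.trace_fin_two, Matrix.det_fin_two,
      Matrix.diagonal_apply_eq] at htr hab hdet
    simp at hab hdet
    rw [htr, hab]
    field_simp
    norm_num
  · have key (k : ℕ) : ∃ s t : ℂ, ((QuotientGroup.mk g : PGL2C) ^ k = 1 ↔ s = 0) ∧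
        a ^ k = s * a + t ∧ b ^ k = s * b + t ∧ (a = b → k * a ^ k = a * s) := by
      obtain ⟨s, t, h, h'⟩ := exists_pow_eq_smul_add_smul_one hM k
      exact ⟨s, t, by rw [hpow, h, smul_add_smul_one_mem_range_scalar_iff hs], h'⟩
    have hne : a ≠ b := by
      intro h
      obtain ⟨s, t, h0, -, -, h1⟩ := key n
      rw [h0.mp (hord ▸ pow_orderOf_eq_one _), mul_zero] at h1
      have := h1 h
      simp [ha] at this
      omega
    have hiff (k : ℕ) : (a / b) ^ k = 1 ↔ (QuotientGroup.mk g : PGL2C) ^ k = 1 := by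
      obtain ⟨s, t, h0, h1, h2, -⟩ := key k
      rw [h0, div_pow, div_eq_one_iff_eq (pow_ne_zero k hb), h1, h2]
      simp [hne]
    refine ⟨a / b, ?_, by field_simp; ring⟩
    rw [IsPrimitiveRoot.iff_def]
    simp only [hiff, ← hord]
    exact ⟨pow_orderOf_eq_one _, fun l => orderOf_dvd_of_pow_eq_one⟩
end

section
/- Every finite subgroup G of PGL₂(ℂ) = GL(2,ℂ)/centre is either cyclic, or isomorphic to a dihedral group D_n for some n ≥ 1 (including the degenerate case of the non-cyclic group of order 4), or isomorphic to A₄, S₄, or A₅. -/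
open MulAction

/-- A group with a cyclic subgroup of index two, all of whose outer elements are involutions, is
dihedral. -/
theorem nonempty_mulEquiv_dihedralGroup {G : Type*} [Group G] [Finite G] (C : Subgroup G)
    [IsCyclic C] (hC : C.index = 2) (hinv : ∀ g ∉ C, g * g = 1) :
    Nonempty (G ≃* DihedralGroup (Nat.card C)) := by
  obtain ⟨s, hs⟩ : ∃ s, s ∉ C := by
    by_contra! h
    simp [(Subgroup.eq_top_iff' C).2 h] at hC
  have : NeZero (Nat.card C) := ⟨Nat.card_pos.ne'⟩
  let φ : Multiplicative (ZMod (Nat.card C)) ≃* C := zmodCyclicMulEquiv ‹_›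
  let ψ : ZMod (Nat.card C) → G := fun i ↦ φ (Multiplicative.ofAdd i)
  have ψmem (i) : ψ i ∈ C := (φ _).2
  have ψadd (i j) : ψ i * ψ j = ψ (i + j) := by simp [ψ]
  have ψneg (i) : ψ (-i) = (ψ i)⁻¹ := by simp [ψ]
  have ψinj : Function.Injective ψ := fun i j h ↦ by simpa [ψ] using h
  have hsψ (i) : s * ψ i ∉ C := by rwa [Subgroup.mul_mem_cancel_right _ (ψmem i)]
  have hcomm (i) : ψ i * s = s * ψ (-i) := by
    have h1 := hinv _ (hsψ i)
    have h2 := hinv s hs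
    rw [ψneg, eq_mul_inv_iff_mul_eq, ← mul_right_inj s, h2, ← h1]
    group
  let f : DihedralGroup (Nat.card C) → G := fun x ↦ match x with
    | .r i => ψ i
    | .sr i => s * ψ i
  let F : DihedralGroup (Nat.card C) →* G := MonoidHom.mk' f <| by
    rintro (i | i) (j | j)
    · simp [f, ψadd]
    · simp only [f, DihedralGroup.r_mul_sr]
      rw [← mul_assoc, hcomm, mul_assoc, ψadd, neg_add_eq_sub]
    · simp [f, ψadd, mul_assoc]
    · simp only [f, DihedralGroup.sr_mul_sr]
      rw [mul_assoc, ← mul_assoc (ψ i), hcomm, mul_assoc, ψadd, neg_add_eq_sub, ← mul_assoc,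
        hinv s hs, one_mul]
  have hF : Function.Injective f := by
    rintro (i | i) (j | j) h <;> simp only [f] at h
    · rw [ψinj h]
    · exact absurd (h ▸ ψmem i) (hsψ j)
    · exact absurd (h ▸ ψmem j) (hsψ i)
    · rw [ψinj (mul_left_cancel h)]
  have hcard : Nat.card (DihedralGroup (Nat.card C)) = Nat.card G := by
    rw [DihedralGroup.nat_card, ← hC, mul_comm, C.card_mul_index]
  exact ⟨(MulEquiv.ofBijective F ((Nat.bijective_iff_injective_and_card _).2 ⟨hF, hcard⟩)).symm⟩

theorem nonempty_mulEquiv_perm {G α : Type*} [Group G] [Finite α] (f : G →* Equiv.Perm α)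
    (hf : Function.Injective f) {n : ℕ} (hα : Nat.card α = n) (hG : Nat.card G = n.factorial) :
    Nonempty (G ≃* Equiv.Perm (Fin n)) := by
  have hcard : Nat.card G = Nat.card (Equiv.Perm α) := by rw [Nat.card_perm, hα, hG]
  exact ⟨(MulEquiv.ofBijective f ((Nat.bijective_iff_injective_and_card _).2 ⟨hf, hcard⟩)).trans
    (Equiv.permCongrHom (Finite.equivFinOfCardEq hα))⟩

theorem nonempty_mulEquiv_alternatingGroup {G α : Type*} [Group G] [Finite α]
    (f : G →* Equiv.Perm α) (hf : Function.Injective f) {n : ℕ} (hα : Nat.card α = n)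
    (hG : 2 * Nat.card G = n.factorial) : Nonempty (G ≃* alternatingGroup (Fin n)) := by
  let e := Equiv.permCongrHom (Finite.equivFinOfCardEq hα)
  let F : G →* Equiv.Perm (Fin n) := e.toMonoidHom.comp f
  have hF : Function.Injective F := e.injective.comp hf
  have hrange : F.range = alternatingGroup (Fin n) := by
    apply Equiv.Perm.eq_alternatingGroup_of_index_eq_two
    have h := F.range.card_mul_index
    rw [Nat.card_perm, Nat.card_fin, ← hG, ← Nat.card_congr (F.ofInjective hF).toEquiv,
      mul_comm 2] at h
    refine Nat.eq_of_mul_eq_mul_left (Nat.pos_of_ne_zero fun h0 ↦ ?_) h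
    exact n.factorial_ne_zero (by rw [← hG, h0])
  exact ⟨(F.ofInjective hF).trans (MulEquiv.subgroupCongr hrange)⟩

/-- If two Sylow `p`-subgroups meet trivially, the kernel of the conjugation action on the Sylow
`p`-subgroups has order prime to `p`. -/
theorem not_dvd_card_ker_toPermHom_sylow {G : Type*} [Group G] [Finite G] {p : ℕ} [Fact p.Prime]
    {P Q : Sylow p G} (hPQ : Disjoint (P : Subgroup G) Q) :
    ¬ p ∣ Nat.card (toPermHom G (Sylow p G)).ker := by
  intro h
  obtain ⟨⟨k, hk⟩, hord⟩ := exists_prime_orderOf_dvd_card' p h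
  rw [Subgroup.orderOf_mk] at hord
  have hp : IsPGroup p (Subgroup.zpowers k) :=
    IsPGroup.of_card (n := 1) (by rw [Nat.card_zpowers, hord, pow_one])
  have hmem (R : Sylow p G) : k ∈ (R : Subgroup G) := by
    have hfix : k • R = R := congrArg (fun σ : Equiv.Perm (Sylow p G) ↦ σ R) hk
    have : k ∈ Subgroup.zpowers k ⊓ Subgroup.normalizer (R : Set G) :=
      ⟨Subgroup.mem_zpowers k, Sylow.smul_eq_iff_mem_normalizer.1 hfix⟩
    rw [hp.inf_normalizer_sylow] at this
    exact this.2
  have hk1 : k = 1 := Subgroup.disjoint_def.1 hPQ (hmem P) (hmem Q)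
  rw [hk1, orderOf_one] at hord
  exact (Fact.out : p.Prime).one_lt.ne hord

theorem card_ker_toPermHom_sylow_mul_dvd {G : Type*} [Group G] [Finite G] {p : ℕ}
    [Fact p.Prime] :
    Nat.card (toPermHom G (Sylow p G)).ker * Nat.card (Sylow p G) ∣ Nat.card G := by
  obtain ⟨P⟩ : Nonempty (Sylow p G) := inferInstance
  rw [P.card_eq_index_normalizer, ← (Subgroup.normalizer (P : Set G)).card_mul_index]
  refine mul_dvd_mul_right (Subgroup.card_dvd_of_le fun k hk ↦ ?_) _
  exact Sylow.smul_eq_iff_mem_normalizer.1 (congrArg (fun σ : Equiv.Perm (Sylow p G) ↦ σ P) hk)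

theorem spherical_triple {N a b c p q r : ℕ} (hN : 0 < N) (hpa : a * p = N) (hqb : b * q = N)
    (hrc : c * r = N) (hp : 2 ≤ p) (hpq : p ≤ q) (hqr : q ≤ r) (h : a + b + c = N + 2) :
    c = 2 ∨ (N = 12 ∧ p = 2 ∧ q = 3 ∧ r = 3) ∨ (N = 24 ∧ p = 2 ∧ q = 3 ∧ r = 4) ∨
      (N = 60 ∧ p = 2 ∧ q = 3 ∧ r = 5) := by
  obtain rfl : p = 2 := by
    by_contra hp'
    have : 3 ≤ p := by omega
    nlinarith
  obtain rfl | rfl | hq : q = 2 ∨ q = 3 ∨ 4 ≤ q := by omega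
  · omega
  · have hr : r < 6 := by
      by_contra! hr
      nlinarith
    interval_cases r <;> omega
  · nlinarith

theorem card_sylow_eq_pow {G : Type*} [Group G] [Finite G] {p k m : ℕ} [hp : Fact p.Prime]
    (hG : Nat.card G = p ^ k * m) (hm : ¬ p ∣ m) (P : Sylow p G) : Nat.card P = p ^ k := by
  have hm0 : m ≠ 0 := by rintro rfl; simp at hm
  rw [P.card_eq_multiplicity, hG, Nat.factorization_mul (pow_ne_zero k hp.out.ne_zero) hm0,
    Finsupp.add_apply, hp.out.factorization_pow, Nat.factorization_eq_zero_of_not_dvd hm]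
  simp

/-- The combinatorial type of the action of a finite group of rotations on the set of its poles:
every nontrivial element has exactly two fixed points, and point stabilizers are cyclic and
nontrivial. -/
structure IsPoleAction (G X : Type*) [Group G] [MulAction G X] : Prop where
  ncard_fixedBy : ∀ g : G, g ≠ 1 → (fixedBy X g).ncard = 2
  isCyclic_stabilizer : ∀ x : X, IsCyclic (stabilizer G x)
  stabilizer_ne_bot : ∀ x : X, stabilizer G x ≠ ⊥

namespace IsPoleAction

variable {G X : Type*} [Group G] [MulAction G X]

theorem ncard_le_two (h : IsPoleAction G X) {g : G} (hg : g ≠ 1) {s : Set X}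
    (hs : s ⊆ fixedBy X g) : s.ncard ≤ 2 := by
  rw [← h.ncard_fixedBy g hg]
  exact Set.ncard_le_ncard hs (Set.finite_of_ncard_pos (by simp [h.ncard_fixedBy g hg]))

theorem exists_smul_eq (h : IsPoleAction G X) {g : G} (hg : g ≠ 1) : ∃ x : X, g • x = x := by
  obtain ⟨x, y, -, hxy⟩ := Set.ncard_eq_two.1 (h.ncard_fixedBy g hg)
  exact ⟨x, show x ∈ fixedBy X g by simp [hxy]⟩

theorem mul_self_eq_one_of_swap (h : IsPoleAction G X) {g : G} {x y : X} (hxy : x ≠ y)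
    (hx : g • x = y) (hy : g • y = x) : g * g = 1 := by
  by_contra hg2
  have hg : g ≠ 1 := by rintro rfl; simp at hg2
  obtain ⟨z, hz⟩ := h.exists_smul_eq hg
  have hzx : z ≠ x := by rintro rfl; exact hxy (hz.symm.trans hx)
  have hzy : z ≠ y := by rintro rfl; exact hxy (hy.symm.trans hz)
  have hcard : ({x, y, z} : Set X).ncard = 3 :=
    Set.ncard_eq_three.2 ⟨x, y, z, hxy, hzx.symm, hzy.symm, rfl⟩
  have := h.ncard_le_two hg2 (s := {x, y, z}) (by
    rintro w (rfl | rfl | rfl) <;> simp [mul_smul, *])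
  omega

theorem ncard_orbit_le_two (h : IsPoleAction G X) {N : Subgroup G} [N.Normal] (hN : N ≠ ⊥)
    {x : X} (hx : N ≤ stabilizer G x) : (orbit G x).ncard ≤ 2 := by
  obtain ⟨n, hn, hn1⟩ := N.bot_or_exists_ne_one.resolve_left hN
  refine h.ncard_le_two hn1 ?_
  rintro _ ⟨g, rfl⟩
  have := hx (Subgroup.Normal.conj_mem' ‹_› n hn g)
  rw [mem_stabilizer_iff, mul_smul, mul_smul, inv_smul_eq_iff] at this
  exact this

theorem eq_bot_of_isCyclic_of_normal (h : IsPoleAction G X) (horb : ∀ x : X, 2 < (orbit G x).ncard)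
    (N : Subgroup G) [N.Normal] [IsCyclic N] : N = ⊥ := by
  by_contra hN
  obtain ⟨n, rfl⟩ := N.isCyclic_iff_exists_zpowers_eq_top.1 ‹_›
  obtain ⟨x, hx⟩ := h.exists_smul_eq (g := n) (by simpa using hN)
  exact (horb x).not_ge (h.ncard_orbit_le_two hN (by simpa using hx))

theorem ncard_orbit_mul_card_stabilizer (x : X) :
    (orbit G x).ncard * Nat.card (stabilizer G x) = Nat.card G := by
  rw [← index_stabilizer, Subgroup.index_mul_card]

theorem nonempty_mulEquiv_alternatingGroup_four (h : IsPoleAction G X) (hG : Nat.card G = 12)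
    {x : X} (hx : Nat.card (stabilizer G x) = 3) : Nonempty (G ≃* alternatingGroup (Fin 4)) := by
  have horb : (orbit G x).ncard = 4 := by
    have := ncard_orbit_mul_card_stabilizer (G := G) x
    rw [hG, hx] at this
    omega
  have : Finite (orbit G x) := Set.finite_of_ncard_pos (by simp [horb])
  refine nonempty_mulEquiv_alternatingGroup (toPermHom G (orbit G x)) ?_ horb (by rw [hG]; rfl)
  refine (injective_iff_map_eq_one _).2 fun g hg ↦ ?_
  by_contra hg1
  have := h.ncard_le_two hg1 (s := orbit G x) fun y hy ↦
    congrArg Subtype.val (congrArg (fun σ : Equiv.Perm (orbit G x) ↦ σ ⟨y, hy⟩) hg)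
  omega

section Finite

variable [Finite G]

theorem two_le_card_stabilizer (h : IsPoleAction G X) (x : X) :
    2 ≤ Nat.card (stabilizer G x) :=
  (stabilizer G x).one_lt_card_iff_ne_bot.2 (h.stabilizer_ne_bot x)

theorem two_mul_card_add_card [Finite X] (h : IsPoleAction G X) :
    2 * Nat.card G + Nat.card X = Nat.card (orbitRel.Quotient G X) * Nat.card G + 2 := by
  classical
  have := Fintype.ofFinite G
  have := Fintype.ofFinite X
  have := sum_card_fixedBy_eq_card_orbits_mul_card_group G X
  simp only [← Nat.card_eq_fintype_card] at this
  rw [orbitRel.Quotient, ← this, ← Finset.add_sum_erase _ _ (Finset.mem_univ 1),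
    Finset.sum_congr (g := fun _ ↦ 2) rfl fun g hg ↦
      (Nat.card_coe_set_eq _).trans (h.ncard_fixedBy g (Finset.ne_of_mem_erase hg))]
  have hpos := Fintype.card_pos (α := G)
  simp [Finset.card_erase_of_mem]
  omega

/-- A nontrivial finite group with a pole action either fixes a pole or has exactly three orbits. -/
theorem exists_stabilizer_eq_top_or_three_orbits [Finite X] [Nontrivial G]
    (h : IsPoleAction G X) :
    (∃ x : X, stabilizer G x = ⊤) ∨ ∃ x : Fin 3 → X, (∀ w, ∃ i, w ∈ orbit G (x i)) ∧
      ∑ i, (orbit G (x i)).ncard = Nat.card G + 2 := by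
  have hburn := h.two_mul_card_add_card
  have hG : 1 < Nat.card G := Finite.one_lt_card
  generalize hk : Nat.card (orbitRel.Quotient G X) = k at hburn
  let e : orbitRel.Quotient G X ≃ Fin k := Finite.equivFinOfCardEq hk
  let x : Fin k → X := fun i ↦ (e.symm i).out
  have hcov (w : X) : ∃ i, w ∈ orbit G (x i) := by
    refine ⟨e (Quotient.mk'' w), ?_⟩
    simp only [x, Equiv.symm_apply_apply]
    exact orbitRel_apply.1 (Quotient.exact' (Quotient.out_eq' (Quotient.mk'' w)).symm)
  have hsum : ∑ i, (orbit G (x i)).ncard = Nat.card X := by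
    have : Finite (orbitRel.Quotient G X) := Quotient.finite _
    have := Fintype.ofFinite (orbitRel.Quotient G X)
    rw [Nat.card_congr (selfEquivSigmaOrbits G X), Nat.card_sigma]
    exact Equiv.sum_comp e.symm fun ω ↦ (orbit G ω.out).ncard
  have hpos (i) : 1 ≤ (orbit G (x i)).ncard :=
    Nat.one_le_iff_ne_zero.2 ((Set.ncard_pos (Set.toFinite _)).2 (nonempty_orbit _)).ne'
  have hle (i) : 2 * (orbit G (x i)).ncard ≤ Nat.card G := by
    rw [← ncard_orbit_mul_card_stabilizer (x i), mul_comm]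
    exact Nat.mul_le_mul_left _ (h.two_le_card_stabilizer _)
  have hkle : 2 * Nat.card X ≤ k * Nat.card G := by
    rw [← hsum, Finset.mul_sum]
    simpa using Finset.sum_le_card_nsmul Finset.univ _ _ fun i _ ↦ hle i
  have hk3 : k < 4 := by
    by_contra! hk4
    nlinarith
  interval_cases k
  · omega
  · have := hpos 0
    simp only [Fin.sum_univ_one] at hsum
    omega
  · left
    have h0 := hpos 0
    have h1 := hpos 1
    simp only [Fin.sum_univ_two] at hsum
    refine ⟨x 0, ?_⟩
    rw [← Subgroup.index_eq_one, index_stabilizer]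
    omega
  · exact .inr ⟨x, hcov, by omega⟩

theorem trichotomy [Finite X] [Nontrivial G] (h : IsPoleAction G X) :
    (∃ x : X, stabilizer G x = ⊤) ∨ (∃ x : X, (orbit G x).ncard = 2) ∨
    ∃ x : Fin 3 → X, (∀ w, ∃ i, w ∈ orbit G (x i)) ∧
      Nat.card (stabilizer G (x 0)) = 2 ∧ Nat.card (stabilizer G (x 1)) = 3 ∧
      ((Nat.card G = 12 ∧ Nat.card (stabilizer G (x 2)) = 3) ∨
       (Nat.card G = 24 ∧ Nat.card (stabilizer G (x 2)) = 4) ∨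
       (Nat.card G = 60 ∧ Nat.card (stabilizer G (x 2)) = 5)) := by
  refine h.exists_stabilizer_eq_top_or_three_orbits.imp_right ?_
  rintro ⟨x, hcov, hsum⟩
  let σ := Tuple.sort fun i ↦ Nat.card (stabilizer G (x i))
  have hσ : Monotone fun i ↦ Nat.card (stabilizer G (x (σ i))) :=
    Tuple.monotone_sort fun i ↦ Nat.card (stabilizer G (x i))
  rw [← Equiv.sum_comp σ, Fin.sum_univ_three] at hsum
  have hmul (i) := ncard_orbit_mul_card_stabilizer (G := G) (x (σ i))
  rcases spherical_triple Nat.card_pos (hmul 0) (hmul 1) (hmul 2) (h.two_le_card_stabilizer _)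
    (hσ (by decide : (0 : Fin 3) ≤ 1)) (hσ (by decide : (1 : Fin 3) ≤ 2)) hsum with
    h2 | h3
  · exact .inl ⟨_, h2⟩
  · refine .inr ⟨x ∘ σ, fun w ↦ ?_, ?_⟩
    · obtain ⟨i, hi⟩ := hcov w
      exact ⟨σ.symm i, by simpa using hi⟩
    · simp only [Function.comp_apply]
      tauto

theorem nonempty_mulEquiv_dihedralGroup_of_ncard_orbit (h : IsPoleAction G X) {x : X}
    (hx : (orbit G x).ncard = 2) :
    Nonempty (G ≃* DihedralGroup (Nat.card (stabilizer G x))) := by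
  have := h.isCyclic_stabilizer x
  refine nonempty_mulEquiv_dihedralGroup _ ((index_stabilizer G x).trans hx) fun g hg ↦ ?_
  have hg' : x ≠ g • x := fun h ↦ hg h.symm
  refine h.mul_self_eq_one_of_swap hg' rfl ?_
  have hpair : ({x, g • x} : Set X) = orbit G x :=
    Set.eq_of_subset_of_ncard_le
      (by rintro w (rfl | rfl); exacts [mem_orbit_self _, mem_orbit _ _])
      (by rw [hx, Set.ncard_pair hg']) (Set.finite_of_ncard_pos (by simp [hx]))
  have hmem : g • g • x ∈ ({x, g • x} : Set X) := by
    rw [hpair, ← mul_smul]; exact mem_orbit _ _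
  exact hmem.resolve_right fun h ↦ hg' (MulAction.injective g h).symm

theorem toPermHom_sylow_injective (h : IsPoleAction G X) (horb : ∀ x : X, 2 < (orbit G x).ncard)
    {p q k : ℕ} [Fact p.Prime] [Fact q.Prime] {P Q : Sylow p G}
    (hPQ : Disjoint (P : Subgroup G) Q)
    (hcard : Nat.card G = p ^ k * q * Nat.card (Sylow p G)) :
    Function.Injective (toPermHom G (Sylow p G)) := by
  rw [← MonoidHom.ker_eq_bot_iff]
  have hdvd := card_ker_toPermHom_sylow_mul_dvd (G := G) (p := p)
  have hndvd := not_dvd_card_ker_toPermHom_sylow hPQ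
  set K := (toPermHom G (Sylow p G)).ker
  have hcop : (Nat.card K).Coprime p := ((Nat.Prime.coprime_iff_not_dvd Fact.out).2 hndvd).symm
  have hK : Nat.card K ∣ q := by
    rw [hcard] at hdvd
    exact (hcop.pow_right k).dvd_of_dvd_mul_left (Nat.dvd_of_mul_dvd_mul_right Nat.card_pos hdvd)
  have : IsCyclic K := by
    rcases (Nat.dvd_prime Fact.out).1 hK with h1 | hq
    · rw [K.eq_bot_of_card_eq h1]; infer_instance
    · exact isCyclic_of_prime_card hq
  exact h.eq_bot_of_isCyclic_of_normal horb K

theorem nonempty_mulEquiv_perm_four (h : IsPoleAction G X) (horb : ∀ x : X, 2 < (orbit G x).ncard)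
    (hG : Nat.card G = 24) : Nonempty (G ≃* Equiv.Perm (Fin 4)) := by
  obtain ⟨P⟩ : Nonempty (Sylow 3 G) := inferInstance
  have hcardP (P : Sylow 3 G) : Nat.card P = 3 :=
    card_sylow_eq_pow (k := 1) (m := 8) hG (by norm_num) P
  have hindex : (P : Subgroup G).index = 8 := by
    have := (P : Subgroup G).card_mul_index
    rw [hG, hcardP] at this
    omega
  have hn1 : Nat.card (Sylow 3 G) ≠ 1 := by
    intro h1
    have : Subsingleton (Sylow 3 G) := (Nat.card_eq_one_iff_unique.1 h1).1
    have : (P : Subgroup G).Normal := P.normal_of_subsingleton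
    have : IsCyclic (P : Subgroup G) := isCyclic_of_prime_card (hcardP P)
    have hP := hcardP P
    rw [h.eq_bot_of_isCyclic_of_normal horb P] at hP
    simp at hP
  have hn : Nat.card (Sylow 3 G) = 4 := by
    have hmod := card_sylow_modEq_one 3 G
    have hdvd := P.card_dvd_index
    rw [hindex] at hdvd
    have := Nat.le_of_dvd (by norm_num) hdvd
    generalize Nat.card (Sylow 3 G) = n at *
    interval_cases n <;> simp_all [Nat.ModEq]
  have : Nontrivial (Sylow 3 G) := Finite.one_lt_card_iff_nontrivial.1 (by omega)
  obtain ⟨Q, hQ⟩ := exists_ne P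
  have hPQ : Disjoint (Q : Subgroup G) P := by
    have hdvd : Nat.card ↥((Q : Subgroup G) ⊓ P) ∣ 3 :=
      (Subgroup.card_dvd_of_le inf_le_left).trans (hcardP Q).dvd
    refine disjoint_iff.2 (((Nat.dvd_prime Nat.prime_three).1 hdvd).elim
      (Subgroup.eq_bot_of_card_eq _) fun h3 ↦ absurd (Sylow.ext ?_) hQ)
    have hinfQ : (Q : Subgroup G) ⊓ P = Q :=
      Subgroup.eq_of_le_of_card_ge inf_le_left (by rw [h3, hcardP])
    have hinfP : (Q : Subgroup G) ⊓ P = P :=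
      Subgroup.eq_of_le_of_card_ge inf_le_right (by rw [h3, hcardP])
    exact hinfQ.symm.trans hinfP
  exact nonempty_mulEquiv_perm _ (h.toPermHom_sylow_injective horb (q := 2) (k := 1) hPQ
    (by rw [hG, hn]; rfl)) hn (by rw [hG]; rfl)

theorem card_centralizer_le (h : IsPoleAction G X) {t : G} (ht : t ≠ 1) {x : X}
    (hx : t • x = x) :
    Nat.card (Subgroup.centralizer {t}) ≤ 2 * Nat.card (stabilizer G x) := by
  rw [← ncard_orbit_mul_card_stabilizer (G := Subgroup.centralizer {t}) x]
  refine Nat.mul_le_mul (h.ncard_le_two ht ?_) ?_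
  · rintro _ ⟨⟨c, hc⟩, rfl⟩
    change t • c • x = c • x
    rw [← mul_smul, ← Subgroup.mem_centralizer_singleton_iff.1 hc, mul_smul, hx]
  · exact Nat.card_le_card_of_injective
      (fun c ↦ (⟨c.1.1, c.2⟩ : stabilizer G x)) fun _ _ hcd ↦
        Subtype.ext (Subtype.ext (Subtype.mk.inj hcd))

theorem nonempty_mulEquiv_alternatingGroup_five [Finite X] (h : IsPoleAction G X)
    (hG : Nat.card G = 60) {x : Fin 3 → X} (hcov : ∀ w, ∃ i, w ∈ orbit G (x i))
    (h0 : Nat.card (stabilizer G (x 0)) = 2) (h1 : Nat.card (stabilizer G (x 1)) = 3)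
    (h2 : Nat.card (stabilizer G (x 2)) = 5) : Nonempty (G ≃* alternatingGroup (Fin 5)) := by
  classical
  have := Fintype.ofFinite G
  have := Fintype.ofFinite X
  have := Fintype.ofFinite (Sylow 2 G)
  have hstab {w y : X} (hw : w ∈ orbit G y) :
      Nat.card (stabilizer G w) = Nat.card (stabilizer G y) := by
    have hw' := ncard_orbit_mul_card_stabilizer (G := G) w
    rw [orbit_eq_iff.2 hw, ← ncard_orbit_mul_card_stabilizer (G := G) y] at hw'
    exact Nat.eq_of_mul_eq_mul_left ((Set.ncard_pos (Set.toFinite _)).2 (nonempty_orbit _)) hw'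
  have horb (w : X) : 2 < (orbit G w).ncard := by
    obtain ⟨i, hi⟩ := hcov w
    have := ncard_orbit_mul_card_stabilizer (G := G) w
    rw [hstab hi, hG] at this
    fin_cases i <;> simp_all <;> omega
  have hcase (w : X) : (w ∈ orbit G (x 0) ∧ Nat.card (stabilizer G w) = 2) ∨
      Nat.card (stabilizer G w) = 3 ∨ Nat.card (stabilizer G w) = 5 := by
    obtain ⟨i, hi⟩ := hcov w
    fin_cases i
    · exact .inl ⟨hi, (hstab hi).trans h0⟩
    · exact .inr (.inl ((hstab hi).trans h1))
    · exact .inr (.inr ((hstab hi).trans h2))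
  have horder {t : G} {w : X} (hw : t • w = w) : orderOf t ∣ Nat.card (stabilizer G w) :=
    Subgroup.orderOf_dvd_natCard _ hw
  have hinv {t : G} (ht : orderOf t = 2) {w : X} (hw : t • w = w) :
      w ∈ orbit G (x 0) ∧ Nat.card (stabilizer G w) = 2 := by
    have := horder hw
    rcases hcase w with h | h | h
    · exact h
    all_goals rw [ht, h] at this; omega
  have hcardP (P : Sylow 2 G) : Nat.card P = 4 :=
    card_sylow_eq_pow (k := 2) (m := 15) hG (by norm_num) P
  have hordP (P : Sylow 2 G) {t : G} (ht : t ∈ P) (ht1 : t ≠ 1) : orderOf t = 2 := by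
    have h4 := hcardP P ▸ Subgroup.orderOf_dvd_natCard _ ht
    obtain ⟨w, hw⟩ := h.exists_smul_eq ht1
    have hd := horder hw
    have hne : orderOf t ≠ 1 := by simpa using ht1
    have hle := Nat.le_of_dvd (by norm_num) h4
    generalize orderOf t = n at *
    rcases hcase w with ⟨-, h'⟩ | h' | h' <;> rw [h'] at hd <;> interval_cases n <;> omega
  have hcentP {P : Sylow 2 G} {t : G} (ht : t ∈ P) (ht1 : t ≠ 1) :
      (P : Subgroup G) = Subgroup.centralizer {t} := by
    obtain ⟨w, hw⟩ := h.exists_smul_eq ht1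
    have := h.card_centralizer_le ht1 hw
    rw [(hinv (hordP P ht ht1) hw).2] at this
    refine Subgroup.eq_of_le_of_card_ge (fun g hg ↦ ?_) (by rw [hcardP]; exact this)
    have hcomm : IsMulCommutative P := IsPGroup.isMulCommutative_of_card_eq_prime_sq
      (p := 2) (hcardP P)
    exact Subgroup.mem_centralizer_singleton_iff.2
      (congrArg Subtype.val (hcomm.is_comm.comm ⟨g, hg⟩ ⟨t, ht⟩))
  have hdisj {P Q : Sylow 2 G} (hPQ : P ≠ Q) : Disjoint (P : Subgroup G) Q := by
    refine Subgroup.disjoint_def.2 fun {t} hP hQ ↦ ?_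
    by_contra ht1
    exact hPQ (Sylow.ext ((hcentP hP ht1).trans (hcentP hQ ht1).symm))
  let T : Finset G := {t | orderOf t = 2}
  have hT {t : G} (ht : t ∈ T) : orderOf t = 2 := by simpa [T] using ht
  have hT1 {t : G} (ht : t ∈ T) : t ≠ 1 := by
    rintro rfl
    simpa using hT ht
  have hcount (H : Subgroup G) (hH : ∀ t ∈ H, t ≠ 1 → orderOf t = 2) :
      (T.filter (· ∈ H)).card = Nat.card H - 1 := by
    have : T.filter (· ∈ H) = (Finset.univ.filter (· ∈ H)).erase 1 := by
      ext t
      simp only [Finset.mem_filter, Finset.mem_erase, Finset.mem_univ, true_and]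
      exact ⟨fun ht ↦ ⟨hT1 ht.1, ht.2⟩, fun ht ↦ ⟨by simpa [T] using hH t ht.2 ht.1, ht.2⟩⟩
    rw [this, Finset.card_erase_of_mem (by simp [one_mem]), Nat.card_eq_fintype_card,
      Fintype.card_subtype]
  have hpoles : T.card * 2 = (orbit G (x 0)).toFinset.card * 1 := by
    refine Finset.card_mul_eq_card_mul (fun t w ↦ t • w = w) (fun t ht ↦ ?_) fun w hw ↦ ?_
    · refine Eq.trans ?_ (h.ncard_fixedBy t (hT1 ht))
      rw [← Set.ncard_coe_finset]
      congr 1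
      ext w
      simpa [Finset.bipartiteAbove] using fun hw ↦ (hinv (hT ht) hw).1
    · have hw2 := (hstab (by simpa using hw)).trans h0
      refine (hcount (stabilizer G w) fun t ht ht1 ↦ ?_).trans (by rw [hw2])
      exact ((Nat.dvd_prime Nat.prime_two).1 (hw2 ▸ horder ht)).resolve_left (by simpa using ht1)
  have hsylow : T.card * 1 = (Finset.univ : Finset (Sylow 2 G)).card * 3 := by
    refine Finset.card_mul_eq_card_mul (fun t P ↦ t ∈ P) (fun t ht ↦ ?_) fun P _ ↦ ?_
    · have hp : IsPGroup 2 (Subgroup.zpowers t) :=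
        IsPGroup.of_card (n := 1) (by rw [Nat.card_zpowers, hT ht, pow_one])
      obtain ⟨P, hP⟩ := hp.exists_le_sylow
      have htP : t ∈ P := hP (Subgroup.mem_zpowers t)
      refine Finset.card_eq_one.2 ⟨P, Finset.eq_singleton_iff_unique_mem.2
        ⟨by simpa [Finset.bipartiteAbove] using htP, fun Q hQ ↦ ?_⟩⟩
      by_contra hQP
      exact hT1 ht (Subgroup.disjoint_def.1 (hdisj hQP)
        ((Finset.mem_bipartiteAbove _).1 hQ).2 htP)
    · exact (hcount P fun t ht ↦ hordP P ht).trans (by rw [hcardP])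
  have hn : Nat.card (Sylow 2 G) = 5 := by
    have h30 := ncard_orbit_mul_card_stabilizer (G := G) (x 0)
    rw [h0, hG, Set.ncard_eq_toFinset_card'] at h30
    rw [Nat.card_eq_fintype_card, ← Finset.card_univ]
    omega
  have : Nontrivial (Sylow 2 G) := Finite.one_lt_card_iff_nontrivial.1 (by omega)
  obtain ⟨P, Q, hPQ⟩ := exists_pair_ne (Sylow 2 G)
  exact nonempty_mulEquiv_alternatingGroup _ (h.toPermHom_sylow_injective horb (q := 3) (k := 2)
    (hdisj hPQ) (by rw [hG, hn]; rfl)) hn (by rw [hG]; rfl)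

/-- The classification of finite groups of rotations, in terms of the action on the poles. -/
theorem classification [Finite X] (h : IsPoleAction G X) :
    IsCyclic G ∨
    (∃ n : ℕ, 1 ≤ n ∧ Nonempty (G ≃* DihedralGroup n)) ∨
    Nonempty (G ≃* alternatingGroup (Fin 4)) ∨
    Nonempty (G ≃* Equiv.Perm (Fin 4)) ∨
    Nonempty (G ≃* alternatingGroup (Fin 5)) := by
  rcases subsingleton_or_nontrivial G with _ | _
  · exact .inl inferInstance
  rcases h.trichotomy with ⟨x, hx⟩ | ⟨x, hx⟩ | ⟨x, hcov, h2, h3, ⟨hG, hc⟩ | ⟨hG, hc⟩ | ⟨hG, hc⟩⟩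
  · have := h.isCyclic_stabilizer x
    rw [hx] at this
    exact .inl (Subgroup.topEquiv.isCyclic.1 this)
  · exact .inr (.inl ⟨_, Nat.card_pos, h.nonempty_mulEquiv_dihedralGroup_of_ncard_orbit hx⟩)
  · exact .inr (.inr (.inl (h.nonempty_mulEquiv_alternatingGroup_four hG hc)))
  · refine .inr (.inr (.inr (.inl (h.nonempty_mulEquiv_perm_four (fun w ↦ ?_) hG))))
    obtain ⟨i, hi⟩ := hcov w
    have := ncard_orbit_mul_card_stabilizer (G := G) (x i)
    rw [orbit_eq_iff.2 hi]
    fin_cases i <;> simp_all <;> omega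
  · exact .inr (.inr (.inr (.inr
      (h.nonempty_mulEquiv_alternatingGroup_five hG hcov h2 h3 hc))))

end Finite

end IsPoleAction

/-- The points with nontrivial stabilizer. -/
def poles (G X : Type*) [Group G] [MulAction G X] : SubMulAction G X where
  carrier := {x | ∃ g : G, g ≠ 1 ∧ g • x = x}
  smul_mem' := by
    rintro h x ⟨g, hg, hx⟩
    exact ⟨h * g * h⁻¹, by simpa using hg, by simp [mul_smul, hx]⟩

theorem finite_poles {G X : Type*} [Group G] [MulAction G X] [Finite G]
    (hfix : ∀ g : G, g ≠ 1 → (fixedBy X g).ncard = 2) : Finite (poles G X) := by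
  refine ((Set.finite_univ (α := G)).biUnion (t := fun g ↦ {x : X | g ≠ 1 ∧ g • x = x})
    fun g _ ↦ ?_).subset fun x ⟨g, hg, hx⟩ ↦ Set.mem_biUnion (Set.mem_univ g) ⟨hg, hx⟩
  by_cases hg : g = 1
  · simp [hg]
  · have hfin : (fixedBy X g).Finite := Set.finite_of_ncard_pos (by rw [hfix g hg]; norm_num)
    exact hfin.subset fun x hx ↦ hx.2

theorem isPoleAction_poles {G X : Type*} [Group G] [MulAction G X]
    (hfix : ∀ g : G, g ≠ 1 → (fixedBy X g).ncard = 2)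
    (hcyc : ∀ x : X, IsCyclic (stabilizer G x)) : IsPoleAction G (poles G X) where
  ncard_fixedBy g hg := by
    rw [← hfix g hg, ← Set.ncard_image_of_injective _ Subtype.val_injective]
    congr 1
    ext x
    constructor
    · rintro ⟨y, hy, rfl⟩
      exact congrArg Subtype.val hy
    · exact fun hx ↦ ⟨⟨x, g, hg, hx⟩, Subtype.ext hx, rfl⟩
  isCyclic_stabilizer x := by
    rw [SubMulAction.stabilizer_of_subMul]
    exact hcyc x
  stabilizer_ne_bot x := by
    obtain ⟨x, g, hg, hx⟩ := x
    rw [SubMulAction.stabilizer_of_subMul]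
    exact fun hbot ↦ hg ((Subgroup.eq_bot_iff_forall _).1 hbot g hx)

section Moebius

open Matrix Matrix.GeneralLinearGroup OnePoint

variable {K : Type*} [Field K]

/-- The eigenvalue of `A` on the line corresponding to a fixed point of `A`. -/
def fixedPointEigenvalue (A : GL (Fin 2) K) (x : OnePoint K) : K :=
  x.elim (A 0 0) fun k ↦ A 1 0 * k + A 1 1

theorem fixedPointEigenvalue_sq_of_mem_center {A : GL (Fin 2) K}
    (hA : A ∈ Subgroup.center (GL (Fin 2) K)) (x : OnePoint K) :
    fixedPointEigenvalue A x ^ 2 = A.val.det := by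
  obtain ⟨a, ha⟩ := mem_center_iff_val_mem_range_scalar.1 hA
  cases x <;> simp [fixedPointEigenvalue, ← ha, sq]

theorem discr_ne_zero_of_pow_mem_center [CharZero K] {A : GL (Fin 2) K} {n : ℕ} (hn : n ≠ 0)
    (hA : A ∉ Subgroup.center (GL (Fin 2) K)) (hAn : A ^ n ∈ Subgroup.center (GL (Fin 2) K)) :
    A.val.discr ≠ 0 := by
  rw [mem_center_iff_val_mem_range_scalar] at hA hAn
  exact fun h ↦ ((show A.IsParabolic from ⟨hA, h⟩).pow hn).1 hAn

theorem discr_out_ne_zero [CharZero K]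
    {G : Subgroup (GL (Fin 2) K ⧸ Subgroup.center (GL (Fin 2) K))} [Finite G] {g : G}
    (hg : g ≠ 1) : g.1.out.val.discr ≠ 0 := by
  refine discr_ne_zero_of_pow_mem_center (orderOf_pos g).ne' ?_ ?_
  · rw [← QuotientGroup.eq_one_iff, QuotientGroup.out_eq']
    simpa using hg
  · rw [← QuotientGroup.eq_one_iff, QuotientGroup.mk_pow, QuotientGroup.out_eq']
    exact_mod_cast pow_orderOf_eq_one g

variable [DecidableEq K]

theorem smul_coe_eq_self_iff {A : GL (Fin 2) K} {k : K} :
    A • (k : OnePoint K) = k ↔ A 0 0 * k + A 0 1 = k * (A 1 0 * k + A 1 1) := by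
  rw [← fixpointPolynomial_aeval_eq_zero_iff]
  simp only [fixpointPolynomial, map_sub, map_mul, map_add, Polynomial.aeval_X_pow,
    Polynomial.aeval_C, Polynomial.aeval_X, Algebra.algebraMap_self_apply]
  grind

theorem fixedPointEigenvalue_mul {A B : GL (Fin 2) K} {x : OnePoint K} (hB : B • x = x) :
    fixedPointEigenvalue (A * B) x = fixedPointEigenvalue A x * fixedPointEigenvalue B x := by
  cases x with
  | infty =>
    rw [smul_infty_eq_self_iff] at hB
    simp [fixedPointEigenvalue, Matrix.mul_apply, Fin.sum_univ_two, hB]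
  | coe k =>
    rw [smul_coe_eq_self_iff] at hB
    simp only [fixedPointEigenvalue, OnePoint.elim_some, Units.val_mul, Matrix.mul_apply,
      Fin.sum_univ_two]
    linear_combination A 1 0 * hB

theorem fixedPointEigenvalue_sq {A : GL (Fin 2) K} {x : OnePoint K} (hA : A • x = x) :
    fixedPointEigenvalue A x ^ 2 - A.val.trace * fixedPointEigenvalue A x + A.val.det = 0 := by
  rw [trace_fin_two, det_fin_two]
  cases x with
  | infty =>
    rw [smul_infty_eq_self_iff] at hA
    simp only [fixedPointEigenvalue, OnePoint.elim_infty]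
    linear_combination -A 0 1 * hA
  | coe k =>
    rw [smul_coe_eq_self_iff] at hA
    simp only [fixedPointEigenvalue, OnePoint.elim_some]
    linear_combination -A 1 0 * hA

theorem smul_eq_self_of_mem_center {A : GL (Fin 2) K}
    (hA : A ∈ Subgroup.center (GL (Fin 2) K)) (x : OnePoint K) : A • x = x := by
  obtain ⟨a, ha⟩ := mem_center_iff_val_mem_range_scalar.1 hA
  cases x with
  | infty => simp [smul_infty_eq_self_iff, ← ha]
  | coe k => simp [smul_coe_eq_self_iff, ← ha, mul_comm]

theorem ncard_fixedBy_of_discr_ne_zero [IsAlgClosed K] [NeZero (2 : K)] {A : GL (Fin 2) K}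
    (hA : A.val.discr ≠ 0) : (fixedBy (OnePoint K) A).ncard = 2 := by
  rw [discr_fin_two, trace_fin_two, det_fin_two] at hA
  refine Set.ncard_eq_two.2 ?_
  by_cases hc : A 1 0 = 0
  · have had : A 1 1 - A 0 0 ≠ 0 := fun h ↦ hA (by rw [hc]; grind)
    refine ⟨∞, (A 0 1 / (A 1 1 - A 0 0) : K), OnePoint.infty_ne_coe _, ?_⟩
    ext x
    cases x with
    | infty => simp [smul_infty_eq_self_iff, hc]
    | coe k =>
      simp only [mem_fixedBy, smul_coe_eq_self_iff, hc, Set.mem_insert_iff,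
        OnePoint.coe_ne_infty, Set.mem_singleton_iff, false_or, OnePoint.coe_eq_coe, eq_div_iff had]
      grind
  · obtain ⟨s, hs⟩ := IsAlgClosed.exists_eq_mul_self (discrim (A 1 0) (A 1 1 - A 0 0) (-A 0 1))
    have h2 : (2 : K) ≠ 0 := two_ne_zero
    have hs0 : s ≠ 0 := by
      rintro rfl
      rw [discrim] at hs
      exact hA (by linear_combination hs)
    refine ⟨((-(A 1 1 - A 0 0) + s) / (2 * A 1 0) : K), ((-(A 1 1 - A 0 0) - s) / (2 * A 1 0) : K),
      ?_, ?_⟩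
    · rw [Ne, OnePoint.coe_eq_coe, div_left_inj' (mul_ne_zero h2 hc)]
      exact fun h ↦ mul_ne_zero h2 hs0 (by linear_combination h)
    · ext x
      cases x with
      | infty => simp [smul_infty_eq_self_iff, hc]
      | coe k =>
        simp only [mem_fixedBy, smul_coe_eq_self_iff, Set.mem_insert_iff, Set.mem_singleton_iff,
          OnePoint.coe_eq_coe, ← quadratic_eq_zero_iff hc hs]
        grind

theorem discr_eq_zero_of_fixedPointEigenvalue_sq_eq_det {A : GL (Fin 2) K} {x : OnePoint K}
    (hA : A • x = x) (h : fixedPointEigenvalue A x ^ 2 = A.val.det) : A.val.discr = 0 := by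
  have h0 : fixedPointEigenvalue A x ≠ 0 := fun h0 ↦ A.det_ne_zero (by rw [← h, h0]; ring)
  have h2 := fixedPointEigenvalue_sq hA
  have htr : A.val.trace = 2 * fixedPointEigenvalue A x :=
    mul_right_cancel₀ h0 (by linear_combination -h2 - h)
  rw [discr_fin_two, htr, ← h]
  ring

instance : MulAction (GL (Fin 2) K ⧸ Subgroup.center (GL (Fin 2) K)) (OnePoint K) :=
  MulAction.compHom _ (QuotientGroup.lift (Subgroup.center (GL (Fin 2) K))
    (toPermHom (GL (Fin 2) K) (OnePoint K)) fun _ hA ↦ Equiv.ext (smul_eq_self_of_mem_center hA))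

theorem out_smul (g : GL (Fin 2) K ⧸ Subgroup.center (GL (Fin 2) K)) (x : OnePoint K) :
    g.out • x = g • x := by
  conv_rhs => rw [← QuotientGroup.out_eq' g]
  rfl

/-- The multiplier at a fixed point of a Möbius transformation. -/
noncomputable def fixedPointMultiplier
    (G : Subgroup (GL (Fin 2) K ⧸ Subgroup.center (GL (Fin 2) K))) (x : OnePoint K) :
    stabilizer G x →* K where
  toFun g := fixedPointEigenvalue g.1.1.out x ^ 2 / g.1.1.out.val.det
  map_one' := by
    rw [fixedPointEigenvalue_sq_of_mem_center, div_self (det_ne_zero _)]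
    rw [← QuotientGroup.eq_one_iff, QuotientGroup.out_eq']
    rfl
  map_mul' g h := by
    have hx (g : stabilizer G x) : g.1.1.out • x = x := (out_smul _ x).trans g.2
    have hz : (g.1.1.out * h.1.1.out)⁻¹ * (g * h).1.1.out ∈
        Subgroup.center (GL (Fin 2) K) := by
      rw [← QuotientGroup.eq, QuotientGroup.mk_mul]
      simp only [QuotientGroup.out_eq']
      rfl
    have hmul : (g * h).1.1.out =
        g.1.1.out * (h.1.1.out * ((g.1.1.out * h.1.1.out)⁻¹ * (g * h).1.1.out)) := by group
    generalize (g.1.1.out * h.1.1.out)⁻¹ * (g * h).1.1.out = z at *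
    have hzx := smul_eq_self_of_mem_center hz x
    have hdz := z.det_ne_zero
    rw [hmul, fixedPointEigenvalue_mul (by rw [mul_smul, hzx, hx]), fixedPointEigenvalue_mul hzx]
    simp only [Units.val_mul, det_mul, mul_pow, fixedPointEigenvalue_sq_of_mem_center hz]
    field_simp

theorem fixedPointMultiplier_injective [CharZero K]
    (G : Subgroup (GL (Fin 2) K ⧸ Subgroup.center (GL (Fin 2) K))) [Finite G] (x : OnePoint K) :
    Function.Injective (fixedPointMultiplier G x) := by
  refine (injective_iff_map_eq_one _).2 fun g hg ↦ ?_
  by_contra hg1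
  refine discr_out_ne_zero (g := g.1) (by simpa using hg1)
    (discr_eq_zero_of_fixedPointEigenvalue_sq_eq_det (x := x) ((out_smul _ x).trans g.2) ?_)
  exact (div_eq_one_iff_eq (det_ne_zero _)).1 hg

end Moebius

theorem finite_subgroups_of_PGL2C (G : Subgroup PGL2C) [Finite G] :
    IsCyclic G ∨
    (∃ n : ℕ, 1 ≤ n ∧ Nonempty (G ≃* DihedralGroup n)) ∨
    Nonempty (G ≃* alternatingGroup (Fin 4)) ∨
    Nonempty (G ≃* Equiv.Perm (Fin 4)) ∨
    Nonempty (G ≃* alternatingGroup (Fin 5)) := by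
  have hfix (g : G) (hg : g ≠ 1) : (fixedBy (OnePoint ℂ) g).ncard = 2 := by
    refine Eq.trans ?_ (ncard_fixedBy_of_discr_ne_zero (discr_out_ne_zero hg))
    congr 1
    ext x
    rw [mem_fixedBy, mem_fixedBy, out_smul]
    rfl
  have := finite_poles hfix
  exact (isPoleAction_poles hfix fun x ↦
    isCyclic_of_injective_ringHom _ (fixedPointMultiplier_injective G x)).classification
end

section
/- Let N ≥ 1, let χ be a Dirichlet character modulo N with values in ℂ, and let f and g be holomorphic modular forms of weight 1 on Γ₁(N) satisfying f|₁γ = χ(d)·f and g|₁γ = χ(d)·g for every γ = (a b; c d) ∈ Γ₀(N) (i.e. f and g are weight-1 forms of level N and character χ). Let M = (1/12)·[SL₂(ℤ) : Γ₀(N)] be the Sturm bound for level N. Then f = g if and only if the coefficients of the q-expansions of f and g at the cusp ∞ agree in all degrees m with m ≤ M. -/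
open ModularForm UpperHalfPlane CongruenceSubgroup SlashInvariantFormClass

open scoped MatrixGroups ModularForm

section SturmBound

open scoped Manifold

variable {𝒢 : Subgroup (GL (Fin 2) ℝ)} {k : ℤ}

/-- The translates of a form by the nontrivial cosets of `𝒢 ⊓ SL(2, ℤ)` in `SL(2, ℤ)`, multiplied
together: the cofactor of `f` in its norm to level one. -/
noncomputable def normCofactor [𝒢.IsArithmetic] (f : ModularForm 𝒢 k) :
    SlashInvariantForm (𝒢 ⊓ 𝒮ℒ)
      (k * (Nat.card (𝒮ℒ ⧸ 𝒢.subgroupOf 𝒮ℒ) - 1 : ℕ)) where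
  toFun :=
    let := Fintype.ofFinite (𝒮ℒ ⧸ 𝒢.subgroupOf 𝒮ℒ)
    let := Classical.decEq (𝒮ℒ ⧸ 𝒢.subgroupOf 𝒮ℒ)
    ∏ q ∈ Finset.univ.erase ((1 : 𝒮ℒ) : 𝒮ℒ ⧸ 𝒢.subgroupOf 𝒮ℒ),
      SlashInvariantForm.quotientFunc f q
  slash_action_eq' h hh := by
    let := Fintype.ofFinite (𝒮ℒ ⧸ 𝒢.subgroupOf 𝒮ℒ)
    let := Classical.decEq (𝒮ℒ ⧸ 𝒢.subgroupOf 𝒮ℒ)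
    have hfix : (⟨h, hh.2⟩ : 𝒮ℒ)⁻¹ • ((1 : 𝒮ℒ) : 𝒮ℒ ⧸ 𝒢.subgroupOf 𝒮ℒ) = (1 : 𝒮ℒ) := by
      rw [MulAction.Quotient.smul_coe, smul_eq_mul, mul_one, QuotientGroup.eq]
      simpa [Subgroup.mem_subgroupOf] using hh.1
    have hcard : Nat.card (𝒮ℒ ⧸ 𝒢.subgroupOf 𝒮ℒ) - 1 =
        (Finset.univ.erase ((1 : 𝒮ℒ) : 𝒮ℒ ⧸ 𝒢.subgroupOf 𝒮ℒ)).card := by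
      rw [Finset.card_erase_of_mem (Finset.mem_univ _), Finset.card_univ,
        Nat.card_eq_fintype_card]
    simp only [hcard]
    rw [ModularForm.prod_slash, Subgroup.HasDetPlusMinusOne.abs_det hh.2]
    simp only [one_zpow, one_smul, SlashInvariantForm.quotientFunc_smul f hh.2]
    refine Finset.prod_equiv (MulAction.toPerm (⟨h, hh.2⟩ : 𝒮ℒ)⁻¹) (fun q ↦ ?_) (fun _ _ ↦ rfl)
    simp only [Finset.mem_erase, Finset.mem_univ, and_true, MulAction.toPerm_apply, ne_eq]
    nth_rw 2 [← hfix]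
    rw [smul_left_cancel_iff]

lemma mul_normCofactor [𝒢.IsArithmetic] (f : ModularForm 𝒢 k) :
    (f : ℍ → ℂ) * normCofactor f = ModularForm.norm 𝒮ℒ f := by
  let := Fintype.ofFinite (𝒮ℒ ⧸ 𝒢.subgroupOf 𝒮ℒ)
  let := Classical.decEq (𝒮ℒ ⧸ 𝒢.subgroupOf 𝒮ℒ)
  have h1 : SlashInvariantForm.quotientFunc f ((1 : 𝒮ℒ) : 𝒮ℒ ⧸ 𝒢.subgroupOf 𝒮ℒ) = f :=
    (SlashInvariantForm.quotientFunc_mk f (1 : 𝒮ℒ)).trans (by simp)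
  rw [ModularForm.coe_norm]
  conv_lhs => rw [← h1]
  exact Finset.mul_prod_erase _ _ (Finset.mem_univ _)

lemma mdifferentiable_normCofactor [𝒢.IsArithmetic] (f : ModularForm 𝒢 k) :
    MDiff (normCofactor f : ℍ → ℂ) :=
  .prod (Quotient.forall.mpr fun ⟨r, _⟩ _ ↦ (translate f r⁻¹).holo')

lemma isBoundedAtImInfty_normCofactor [𝒢.IsArithmetic] (f : ModularForm 𝒢 k) :
    IsBoundedAtImInfty (normCofactor f) := by
  refine Filter.BoundedAtFilter.prod _ (Quotient.forall.mpr ?_)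
  rintro ⟨_, g, rfl⟩ _
  simpa [SL_slash] using! ModularFormClass.bdd_at_infty_slash f g⁻¹

/-- **Sturm bound for arithmetic subgroups.** -/
theorem sturm_bound_of_isArithmetic [𝒢.IsArithmetic] (h𝒢 : 1 ∈ 𝒢.strictPeriods)
    (f : ModularForm 𝒢 k)
    (h : (((k * 𝒢.relIndex 𝒮ℒ).toNat / 12 : ℕ) : ℕ∞) < (qExpansion 1 f).order) : f = 0 := by
  have hperiod : (1 : ℝ) ∈ (𝒢 ⊓ 𝒮ℒ).strictPeriods := by
    rw [Subgroup.mem_strictPeriods_iff]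
    exact ⟨Subgroup.mem_strictPeriods_iff.mp h𝒢,
      Subgroup.mem_strictPeriods_iff.mp (one_mem_strictPeriods_SL)⟩
  suffices ModularForm.norm 𝒮ℒ f = 0 by
    rw [ModularForm.norm_eq_zero_iff] at this
    exact DFunLike.coe_injective this
  refine sturm_bound_levelOne (h.trans_le ?_)
  rw [← mul_normCofactor, UpperHalfPlane.qExpansion_mul
    (ModularFormClass.analyticAt_cuspFunction_zero f one_pos h𝒢)
    (UpperHalfPlane.analyticAt_cuspFunction_zero one_pos
      (periodic_comp_ofComplex (normCofactor f) hperiod)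
      (mdifferentiable_normCofactor f) (isBoundedAtImInfty_normCofactor f)),
    PowerSeries.order_mul]
  exact le_self_add

lemma relIndex_map_mapGL_eq_index (Γ : Subgroup SL(2, ℤ)) :
    (Γ : Subgroup (GL (Fin 2) ℝ)).relIndex 𝒮ℒ = Γ.index := by
  rw [MonoidHom.range_eq_map, Subgroup.relIndex_map_map_of_injective _ _
    Matrix.SpecialLinearGroup.mapGL_injective, Subgroup.relIndex_top_right]

lemma SL_pow_slash (f : ℍ → ℂ) (k : ℤ) (n : ℕ) (γ : SL(2, ℤ)) :
    (f ^ n) ∣[(n * k : ℤ)] γ = (f ∣[k] γ) ^ n := by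
  ext τ
  simp [SL_slash_apply, mul_pow, mul_comm (n : ℤ), zpow_mul]

lemma isUnit_intCast_of_mem_Gamma0 {N : ℕ} {γ : SL(2, ℤ)} (hγ : γ ∈ Gamma0 N) :
    IsUnit ((γ 1 1 : ℤ) : ZMod N) := by
  have hdet := congrArg (Int.cast : ℤ → ZMod N) γ.det_coe
  rw [Matrix.det_fin_two] at hdet
  push_cast at hdet
  rw [Gamma0_mem.mp hγ, mul_zero, sub_zero] at hdet
  exact IsUnit.of_mul_eq_one_right _ hdet

/-- If `f` is a form with character `χ` for `Γ₀(N)` and `χ ^ n = 1`, then `f ^ n` is a modular form for `Γ₀(N)`. -/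
noncomputable def powGamma0 {N : ℕ} [NeZero N] {χ : DirichletCharacter ℂ N} {n : ℕ}
    (hχ : χ ^ n = 1) (f : ModularForm (Gamma1 N) k)
    (hf : ∀ γ : SL(2, ℤ), γ ∈ Gamma0 N → (⇑f ∣[k] γ) = χ ((γ 1 1 : ℤ) : ZMod N) • ⇑f) :
    ModularForm (Gamma0 N) (n * k) where
  toFun := f ^ n
  slash_action_eq' := by
    rintro _ ⟨γ, hγ, rfl⟩
    have hone : χ ((γ 1 1 : ℤ) : ZMod N) ^ n = 1 := by
      obtain ⟨u, hu⟩ := isUnit_intCast_of_mem_Gamma0 hγ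
      rw [← hu, ← MulChar.pow_apply_coe, hχ, MulChar.one_apply_coe]
    have := SL_pow_slash f k n γ
    rwa [hf γ hγ, smul_pow, hone, one_smul] at this
  holo' := by
    simpa using! (f.pow n).holo'
  bdd_at_cusps' hc := by
    rw [Subgroup.IsArithmetic.isCusp_iff_isCusp_SL2Z,
      ← Subgroup.IsArithmetic.isCusp_iff_isCusp_SL2Z (Gamma1 N : Subgroup (GL (Fin 2) ℝ))] at hc
    simpa using! (f.pow n).bdd_at_cusps' hc

/-- **Sturm bound for forms with character.** -/
theorem sturm_bound_of_character {N : ℕ} [NeZero N] {χ : DirichletCharacter ℂ N}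
    (f : ModularForm (Gamma1 N) k)
    (hf : ∀ γ : SL(2, ℤ), γ ∈ Gamma0 N → (⇑f ∣[k] γ) = χ ((γ 1 1 : ℤ) : ZMod N) • ⇑f)
    (h : (((k * (Gamma0 N).index).toNat / 12 : ℕ) : ℕ∞) < (qExpansion 1 f).order) : f = 0 := by
  obtain ⟨n, hn, hχ⟩ : ∃ n, 0 < n ∧ χ ^ n = 1 := (isOfFinOrder_of_finite χ).exists_pow_eq_one
  have hpow : qExpansion 1 (powGamma0 hχ f hf) = qExpansion 1 f ^ n := by
    rw [← ModularForm.qExpansion_pow one_pos (by simp) f n, ModularForm.coe_pow]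
    rfl
  have hzero : powGamma0 hχ f hf = 0 := by
    refine sturm_bound_of_isArithmetic (by simp) _ ?_
    rw [hpow, PowerSeries.order_pow, relIndex_map_mapGL_eq_index]
    refine lt_of_lt_of_le ?_ (nsmul_le_nsmul_right (Order.add_one_le_of_lt h) n)
    rw [nsmul_eq_mul, mul_assoc]
    norm_cast
    rcases le_total 0 (k * (Gamma0 N).index) with hk | hk
    · rw [Int.toNat_mul (by positivity) hk, Int.toNat_natCast, Nat.div_lt_iff_lt_mul (by norm_num),
        mul_assoc]
      exact Nat.mul_lt_mul_of_pos_left (by lia) hn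
    · rw [Int.toNat_of_nonpos (mul_nonpos_of_nonneg_of_nonpos (by positivity) hk)]
      simpa using hn
  ext τ
  have := DFunLike.congr_fun hzero τ
  exact eq_zero_of_pow_eq_zero (n := n) this

end SturmBound

theorem sturm_bound_weight_one
    (N : ℕ) (hN : 1 ≤ N) (χ : DirichletCharacter ℂ N)
    (f g : ModularForm (Gamma1 N) 1)
    (hf : ∀ γ : SL(2, ℤ), γ ∈ Gamma0 N →
      (⇑f ∣[(1 : ℤ)] γ) = χ ((γ 1 1 : ℤ) : ZMod N) • ⇑f)
    (hg : ∀ γ : SL(2, ℤ), γ ∈ Gamma0 N →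
      (⇑g ∣[(1 : ℤ)] γ) = χ ((γ 1 1 : ℤ) : ZMod N) • ⇑g) :
    f = g ↔
      ∀ m : ℕ, (m : ℚ) ≤ ((Gamma0 N).index : ℚ) / 12 →
        iteratedDeriv m (cuspFunction 1 f) 0 / (m.factorial : ℂ) =
          iteratedDeriv m (cuspFunction 1 g) 0 / (m.factorial : ℂ) := by
  have : NeZero N := ⟨by lia⟩
  refine ⟨fun h _ _ ↦ by rw [h], fun h ↦ sub_eq_zero.mp ?_⟩
  refine sturm_bound_of_character (χ := χ) (f - g) (fun γ hγ ↦ ?_) ?_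
  · rw [FunLike.coe_sub, sub_eq_add_neg, SlashAction.add_slash, SlashAction.neg_slash, hf γ hγ,
      hg γ hγ, smul_add, smul_neg]
  · refine (ENat.add_one_le_iff (ENat.natCast_ne_top _)).mp ?_
    refine PowerSeries.nat_le_order _ _ fun m hm ↦ ?_
    rw [FunLike.coe_sub, ModularForm.qExpansion_sub one_pos (by simp) f g, map_sub, sub_eq_zero,
      qExpansion_coeff, qExpansion_coeff, ← div_eq_inv_mul, ← div_eq_inv_mul]
    refine h m ((le_div_iff₀ (by norm_num)).mpr ?_)
    rw [one_mul, Int.toNat_natCast] at hm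
    exact_mod_cast (by lia : m * 12 ≤ (Gamma0 N).index)
end
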